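/- Suppose there exists a bi-orthogonality preserving real-linear bijection T : C_r(L₁) → C_r(L₂) (not assumed bounded). Then there exists a homeomorphism φ : L₂ → L₁ such that φ(F₂) = F₁ and φ(O₂) = O₁; in particular, L₁ and L₂ are homeomorphic. -/

import Mathlib

noncomputable section
set_option synthInstance.maxHeartbeats 1000000
set_option maxHeartbeats 1000000

/-- The real function algebra `C_r(L)` of continuous complex-valued functions on `L` that
take real values on the closed subset `F ⊆ L`, viewed as a real subalgebra of `C(L, ℂ)`
(with pointwise operations; the involution is pointwise conjugation and the norm is the sup
norm, both inherited from `C(L, ℂ)`). -/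
def Cr (L : Type*) [TopologicalSpace L] (F : Set L) : Subalgebra ℝ C(L, ℂ) where
  carrier := {f : C(L, ℂ) | ∀ t ∈ F, (f t).im = 0}
  mul_mem' := by
    intro f g hf hg t ht
    simp [Complex.mul_im, hf t ht, hg t ht]
  one_mem' := by intro t ht; simp
  add_mem' := by intro f g hf hg t ht; simp [hf t ht, hg t ht]
  zero_mem' := by intro t ht; simp
  algebraMap_mem' := by intro r t ht; simp

open Filter Topology

namespace Cr

variable {L L₁ L₂ : Type*} [TopologicalSpace L] [TopologicalSpace L₁] [TopologicalSpace L₂]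
  {F : Set L} {F₁ : Set L₁} {F₂ : Set L₂}

/-- The value of `f ∈ C_r(L)` at a point. -/
def ev (f : Cr L F) (t : L) : ℂ := (f : C(L, ℂ)) t

@[fun_prop]
lemma continuous_ev (f : Cr L F) : Continuous (ev f) := (f : C(L, ℂ)).continuous

lemma im_ev (f : Cr L F) {t : L} (ht : t ∈ F) : (ev f t).im = 0 := f.2 t ht

@[ext]
lemma ext_ev {f g : Cr L F} (h : ∀ t, ev f t = ev g t) : f = g :=
  Subtype.ext (ContinuousMap.ext h)

@[simp] lemma ev_add (f g : Cr L F) (t : L) : ev (f + g) t = ev f t + ev g t := rfl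
@[simp] lemma ev_sub (f g : Cr L F) (t : L) : ev (f - g) t = ev f t - ev g t := rfl
@[simp] lemma ev_mul (f g : Cr L F) (t : L) : ev (f * g) t = ev f t * ev g t := rfl
@[simp] lemma ev_zero (t : L) : ev (0 : Cr L F) t = 0 := rfl
@[simp] lemma ev_one (t : L) : ev (1 : Cr L F) t = 1 := rfl
@[simp] lemma ev_smul (c : ℝ) (f : Cr L F) (t : L) : ev (c • f) t = (c : ℂ) * ev f t := by
  change c • ev f t = _
  simp

@[simp] lemma ev_sum {ι : Type*} (s : Finset ι) (f : ι → Cr L F) (t : L) :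
    ev (∑ i ∈ s, f i) t = ∑ i ∈ s, ev (f i) t := by
  classical
  induction s using Finset.induction_on with
  | empty => simp
  | insert a s ha ih => simp [Finset.sum_insert ha, ih]

lemma mul_eq_zero_iff (f g : Cr L F) : f * g = 0 ↔ ∀ t, ev f t = 0 ∨ ev g t = 0 := by
  rw [Cr.ext_ev_iff]
  simp

/-- A continuous function which is real on `F`, as an element of `C_r(L)`. -/
def mk (f : L → ℂ) (hf : Continuous f) (h : ∀ t ∈ F, (f t).im = 0) : Cr L F := ⟨⟨f, hf⟩, h⟩

@[simp] lemma ev_mk (f : L → ℂ) (hf : Continuous f) (h : ∀ t ∈ F, (f t).im = 0) (t : L) :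
    ev (mk f hf h) t = f t := rfl

/-- A real continuous function as an element of `C_r(L)`. -/
def ofReal (F : Set L) (χ : C(L, ℝ)) : Cr L F :=
  mk (fun t => (χ t : ℂ)) (by fun_prop) (by simp)

@[simp] lemma ev_ofReal (χ : C(L, ℝ)) (t : L) : ev (ofReal F χ) t = χ t := rfl

lemma notMem_tsupport_iff (f : Cr L F) (t : L) :
    t ∉ tsupport (ev f) ↔ ∀ᶠ x in 𝓝 t, ev f x = 0 :=
  notMem_tsupport_iff_eventuallyEq

/-- If `T` is orthogonality preserving, every point `s` has a support point `t` for `δ_s ∘ T`. -/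
lemma exists_support_point [CompactSpace L₁] [T2Space L₁] (T : Cr L₁ F₁ →ₗ[ℝ] Cr L₂ F₂)
    (hT : ∀ f g, f * g = 0 → T f * T g = 0) (hsurj : Function.Surjective T) (s : L₂) :
    ∃ t, ∀ f, ev (T f) s ≠ 0 → t ∈ tsupport (ev f) := by
  by_contra! h
  choose f hf hft using h
  obtain ⟨I, hI⟩ := isCompact_univ.elim_finite_subcover (fun t => (tsupport (ev (f t)))ᶜ)
    (fun t => (isClosed_tsupport _).isOpen_compl) (fun t _ => Set.mem_iUnion.2 ⟨t, hft t⟩)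
  obtain ⟨ρ, hρ⟩ := PartitionOfUnity.exists_isSubordinate isClosed_univ
    (fun i : I => (tsupport (ev (f i)))ᶜ) (fun t => (isClosed_tsupport _).isOpen_compl)
    (fun t ht => by
      obtain ⟨i, hi, hit⟩ := Set.mem_iUnion₂.1 (hI ht)
      exact Set.mem_iUnion.2 ⟨⟨i, hi⟩, hit⟩)
  obtain ⟨g, hg⟩ := hsurj 1
  have hsum : g = ∑ i : I, ofReal F₁ (ρ i) * g := by
    ext t
    have := ρ.sum_eq_one (Set.mem_univ t)
    rw [finsum_eq_sum_of_fintype] at this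
    simp only [ev_sum, ev_mul, ev_ofReal, ← Finset.sum_mul]
    rw [← Complex.ofReal_sum, this]
    simp
  have hzero : ∀ i : I, ev (T (ofReal F₁ (ρ i) * g)) s = 0 := by
    intro i
    have hm : (ofReal F₁ (ρ i) * g) * f i = 0 := by
      rw [mul_eq_zero_iff]
      intro t
      by_cases ht : t ∈ tsupport (ρ i)
      · exact Or.inr (image_eq_zero_of_notMem_tsupport (hρ i ht))
      · left
        simp [image_eq_zero_of_notMem_tsupport ht]
    exact ((mul_eq_zero_iff _ _).1 (hT _ _ hm) s).resolve_right (hf i)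
  have h1 : ev (T g) s = 0 := by
    rw [hsum, map_sum, ev_sum]
    exact Finset.sum_eq_zero fun i _ => hzero i
  simp [hg] at h1

lemma exists_bump [CompactSpace L] [T2Space L] (F : Set L) {t t' : L} (h : t ≠ t') :
    ∃ f : Cr L F, (∀ᶠ x in 𝓝 t, ev f x = 1) ∧ ∀ᶠ x in 𝓝 t', ev f x = 0 := by
  obtain ⟨U, V, hU, hV, htU, htV, hUV⟩ := t2_separation h
  obtain ⟨A, hA, hAc, hAU⟩ := exists_mem_nhds_isClosed_subset (hU.mem_nhds htU)
  obtain ⟨B, hB, hBc, hBV⟩ := exists_mem_nhds_isClosed_subset (hV.mem_nhds htV)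
  obtain ⟨χ, h0, h1, -⟩ := exists_continuous_zero_one_of_isClosed hBc hAc
    (hUV.symm.mono hBV hAU)
  refine ⟨ofReal F χ, ?_, ?_⟩
  · filter_upwards [hA] with x hx
    simp [h1 hx]
  · filter_upwards [hB] with x hx
    simp [h0 hx]

lemma support_point_unique [CompactSpace L₁] [T2Space L₁] (T : Cr L₁ F₁ →ₗ[ℝ] Cr L₂ F₂)
    (hsurj : Function.Surjective T) (s : L₂) {t t' : L₁}
    (ht : ∀ f, ev (T f) s ≠ 0 → t ∈ tsupport (ev f))
    (ht' : ∀ f, ev (T f) s ≠ 0 → t' ∈ tsupport (ev f)) : t = t' := by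
  by_contra hne
  obtain ⟨χ, h1, h0⟩ := exists_bump F₁ hne
  obtain ⟨g, hg⟩ := hsurj 1
  have ha : ev (T (χ * g)) s = 0 := by
    by_contra hc
    refine (notMem_tsupport_iff _ _).2 ?_ (ht' _ hc)
    filter_upwards [h0] with x hx
    simp [hx]
  have hb : ev (T (g - χ * g)) s = 0 := by
    by_contra hc
    refine (notMem_tsupport_iff _ _).2 ?_ (ht _ hc)
    filter_upwards [h1] with x hx
    simp [hx]
  rw [map_sub, ev_sub, ha, hg] at hb
  simp at hb

lemma exists_support_map [CompactSpace L₁] [T2Space L₁] (T : Cr L₁ F₁ →ₗ[ℝ] Cr L₂ F₂)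
    (hT : ∀ f g, f * g = 0 → T f * T g = 0) (hsurj : Function.Surjective T) :
    ∃ φ : L₂ → L₁, Continuous φ ∧
      ∀ f s, s ∈ tsupport (ev (T f)) → φ s ∈ tsupport (ev f) := by
  choose φ hφ using exists_support_point T hT hsurj
  have hcont : Continuous φ := by
    rw [continuous_iff_isClosed]
    intro C hC
    have hgraph : IsClosed {p : L₁ × L₂ | ∀ f, ev (T f) p.2 = 0 ∨ p.1 ∈ tsupport (ev f)} := by
      simp only [Set.ofPred_forall, Set.ofPred_or]
      exact isClosed_iInter fun f => (isClosed_eq (by fun_prop) continuous_const).union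
        ((isClosed_tsupport _).preimage continuous_fst)
    convert isClosedMap_snd_of_compactSpace _ (hgraph.inter (hC.preimage continuous_fst))
    ext s
    simp only [Set.mem_preimage, Set.mem_image, Set.mem_inter_iff, Set.mem_ofPred_eq,
      Prod.exists, exists_eq_right]
    constructor
    · exact fun h => ⟨φ s, fun f => or_iff_not_imp_left.2 (hφ s f), h⟩
    · rintro ⟨t, ht, htC⟩
      rwa [support_point_unique T hsurj s (hφ s) fun f => or_iff_not_imp_left.1 (ht f)]
  refine ⟨φ, hcont, fun f s hs => ?_⟩
  exact closure_minimal (fun x hx => hφ x f hx)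
    ((isClosed_tsupport (ev f)).preimage hcont) hs

lemma support_map_comp [CompactSpace L₂] [T2Space L₂] {T : Cr L₁ F₁ →ₗ[ℝ] Cr L₂ F₂}
    (hsurj : Function.Surjective T) {φ : L₂ → L₁} {ψ : L₁ → L₂}
    (hφ : ∀ f s, s ∈ tsupport (ev (T f)) → φ s ∈ tsupport (ev f))
    (hψ : ∀ f t, t ∈ tsupport (ev f) → ψ t ∈ tsupport (ev (T f))) (s : L₂) :
    ψ (φ s) = s := by
  by_contra hne
  obtain ⟨χ, h1, h0⟩ := exists_bump F₂ (Ne.symm hne)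
  obtain ⟨g, rfl⟩ := hsurj χ
  refine (notMem_tsupport_iff _ _).2 h0 (hψ _ _ (hφ _ _ (subset_tsupport _ ?_)))
  simp [h1.self_of_nhds]

/-- A continuous cutoff function on `ℂ` for the circle of radius `ρ`. -/
lemma exists_annulus_bump {ρ : ℝ} (hρ : 0 < ρ) :
    ∃ χ : ℂ → ℝ, Continuous χ ∧ (∀ z, 0 ≤ χ z) ∧ (∀ z, χ z ≤ 1) ∧
      (∀ z, ‖z‖ ≤ ρ / 2 ∨ 3 / 2 * ρ ≤ ‖z‖ → χ z = 0) ∧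
      ∀ z, 3 / 4 * ρ < ‖z‖ → ‖z‖ < 5 / 4 * ρ → χ z = 1 := by
  refine ⟨fun z => max 0 (min 1 (2 - 4 * |‖z‖ / ρ - 1|)), by fun_prop,
    fun z => le_max_left _ _, fun z => max_le zero_le_one (min_le_left _ _), ?_, ?_⟩
  · intro z h
    refine max_eq_left ((min_le_right _ _).trans ?_)
    have : 1 / 2 ≤ |‖z‖ / ρ - 1| := by
      rw [le_abs]
      rcases h with h | h
      · right
        have : ‖z‖ / ρ ≤ 1 / 2 := by rw [div_le_iff₀ hρ]; linarith
        linarith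
      · left
        have : 3 / 2 ≤ ‖z‖ / ρ := by rwa [le_div_iff₀ hρ]
        linarith
    linarith
  · intro z h h'
    have : |‖z‖ / ρ - 1| ≤ 1 / 4 := by
      rw [abs_le]
      have h1 : 3 / 4 < ‖z‖ / ρ := by rwa [lt_div_iff₀ hρ]
      have h2 : ‖z‖ / ρ < 5 / 4 := by rwa [div_lt_iff₀ hρ]
      constructor <;> linarith
    beta_reduce
    rw [min_eq_left (by linarith), max_eq_right zero_le_one]

/-- A continuous function on `ℂ` which is multiplication by `k` near the circle of radius `r k`,
for a sequence of radii decreasing fast enough. -/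
lemma exists_amplifier (r : ℕ → ℝ) (hpos : ∀ k, 0 < r k) (hr : ∀ k, r (k + 1) ≤ r k / 4) :
    ∃ H : ℂ → ℂ, Continuous H ∧ (∀ z, z.im = 0 → (H z).im = 0) ∧
      ∀ k z, ‖z‖ = r k → ∀ᶠ w in 𝓝 z, H w = ((k : ℝ) : ℂ) * w := by
  choose χ hχc hχ0 hχ1 hχz hχo using fun k => exists_annulus_bump (hpos k)
  have hgeom : ∀ k, r k ≤ r 0 * (1 / 4) ^ k := by
    intro k
    induction k with
    | zero => simp
    | succ k ih => rw [pow_succ]; linarith [hr k]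
  have hanti : Antitone r := antitone_nat_of_succ_le fun k => by linarith [hr k, hpos k]
  have hbound : ∀ k z, ‖((k * χ k z : ℝ) : ℂ) * z‖ ≤
      3 / 2 * r 0 * ((k : ℝ) ^ 1 * (1 / 4) ^ k) := by
    intro k z
    have hk : (0 : ℝ) ≤ k := k.cast_nonneg
    have hχzr : χ k z * ‖z‖ ≤ 3 / 2 * (r 0 * (1 / 4) ^ k) := by
      rcases le_total (3 / 2 * r k) ‖z‖ with h | h
      · rw [hχz k z (Or.inr h)]
        have := hpos 0
        simp only [zero_mul]
        positivity
      · calc χ k z * ‖z‖ ≤ 1 * ‖z‖ := by gcongr; exact hχ1 k z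
          _ ≤ _ := by linarith [hgeom k]
    rw [norm_mul, Complex.norm_real, Real.norm_of_nonneg (mul_nonneg hk (hχ0 k z))]
    nlinarith [mul_le_mul_of_nonneg_left hχzr hk]
  have hsummable : Summable fun k : ℕ => 3 / 2 * r 0 * ((k : ℝ) ^ 1 * (1 / 4) ^ k) := by
    have hq : ‖(1 / 4 : ℝ)‖ < 1 := by norm_num
    exact (summable_pow_mul_geometric_of_norm_lt_one 1 hq).mul_left _
  have hterm : ∀ z, Summable fun k : ℕ => ((k * χ k z : ℝ) : ℂ) * z := fun z =>
    Summable.of_norm_bounded hsummable fun k => hbound k z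
  refine ⟨fun z => ∑' k : ℕ, ((k * χ k z : ℝ) : ℂ) * z, ?_, ?_, ?_⟩
  · exact continuous_tsum (fun k => by have := hχc k; fun_prop) hsummable hbound
  · intro z hz
    rw [Complex.im_tsum (hterm z)]
    simp [hz]
  · intro k z hz
    have h1 : ∀ᶠ w : ℂ in 𝓝 z, 3 / 4 * r k < ‖w‖ :=
      continuous_norm.continuousAt.eventually (lt_mem_nhds (by linarith [hpos k]))
    have h2 : ∀ᶠ w : ℂ in 𝓝 z, ‖w‖ < 5 / 4 * r k :=
      continuous_norm.continuousAt.eventually (gt_mem_nhds (by linarith [hpos k]))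
    filter_upwards [h1, h2] with w hw1 hw2
    rw [tsum_eq_single k, hχo k w hw1 hw2, mul_one]
    intro j hj
    rw [hχz j w, mul_zero, Complex.ofReal_zero, zero_mul]
    rcases lt_or_gt_of_ne hj with h | h
    · left
      linarith [hr j, hanti (Nat.succ_le_of_lt h), hpos j]
    · right
      linarith [hr k, hanti (Nat.succ_le_of_lt h), hpos k]

/-- The support map intertwines evaluations: `T f` vanishes at `s` when `f` vanishes at `φ s`. -/
lemma ev_eq_zero_of_ev_support_eq_zero [CompactSpace L₂] (T : Cr L₁ F₁ →ₗ[ℝ] Cr L₂ F₂)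
    (φ : L₂ ≃ₜ L₁) (hφ : ∀ f s, s ∈ tsupport (ev (T f)) → φ s ∈ tsupport (ev f))
    (f : Cr L₁ F₁) (s : L₂) (hf : ev f (φ s) = 0) : ev (T f) s = 0 := by
  have hlocal : ∀ f s, (∀ᶠ x in 𝓝 (φ s), ev f x = 0) → ev (T f) s = 0 := fun f s h =>
    image_eq_zero_of_notMem_tsupport fun hs => (notMem_tsupport_iff _ _).2 h (hφ f s hs)
  by_contra hne
  obtain ⟨δ, hδ, hδs⟩ := exists_between (norm_pos_iff.2 hne)
  have hfreq : ∃ᶠ x in 𝓝 (φ s), ev f x ≠ 0 := fun h => hne (hlocal f s (by simpa using h))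
  have hnear : ∀ᶠ x in 𝓝 (φ s), δ < ‖ev (T f) (φ.symm x)‖ := by
    have hc : Continuous fun x => ‖ev (T f) (φ.symm x)‖ := by fun_prop
    exact hc.continuousAt.eventually (lt_mem_nhds (by simpa using hδs))
  have hpick : ∀ ε > 0, ∃ x, δ < ‖ev (T f) (φ.symm x)‖ ∧ ev f x ≠ 0 ∧ ‖ev f x‖ < ε := by
    intro ε hε
    have hc : Continuous fun x => ‖ev f x‖ := by fun_prop
    have hsmall : ∀ᶠ x in 𝓝 (φ s), ‖ev f x‖ < ε :=
      hc.continuousAt.eventually (gt_mem_nhds (by simpa [hf] using hε))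
    obtain ⟨x, h0, h1, h2⟩ := (hfreq.and_eventually (hnear.and hsmall)).exists
    exact ⟨x, h1, h0, h2⟩
  have : Nonempty L₁ := ⟨φ s⟩
  choose! next hnext using hpick
  let x : ℕ → L₁ := fun n => n.rec (next 1) fun _ y => next (‖ev f y‖ / 4)
  have hx : ∀ k, δ < ‖ev (T f) (φ.symm (x k))‖ ∧ ev f (x k) ≠ 0 := by
    intro k
    induction k with
    | zero => exact ⟨(hnext 1 one_pos).1, (hnext 1 one_pos).2.1⟩
    | succ k ih =>
      have h := hnext (‖ev f (x k)‖ / 4) (by have := norm_pos_iff.2 ih.2; positivity)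
      exact ⟨h.1, h.2.1⟩
  have hxr : ∀ k, ‖ev f (x (k + 1))‖ ≤ ‖ev f (x k)‖ / 4 := fun k =>
    (hnext (‖ev f (x k)‖ / 4) (by have := norm_pos_iff.2 (hx k).2; positivity)).2.2.le
  obtain ⟨H, hH, hHre, hHk⟩ := exists_amplifier (fun k => ‖ev f (x k)‖)
    (fun k => norm_pos_iff.2 (hx k).2) hxr
  let g : Cr L₁ F₁ := mk (fun t => H (ev f t)) (by fun_prop) fun t ht => hHre _ (im_ev f ht)
  have hg : ∀ k : ℕ, ev (T g) (φ.symm (x k)) = ((k : ℝ) : ℂ) * ev (T f) (φ.symm (x k)) := by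
    intro k
    have := hlocal (g + (-(k : ℝ)) • f) (φ.symm (x k)) (by
      rw [φ.apply_symm_apply]
      filter_upwards [(continuous_ev f).continuousAt.eventually (hHk k _ rfl)] with y hy
      simp only [ev_add, ev_smul, g, ev_mk]
      rw [hy]
      push_cast
      ring)
    rw [map_add, map_smul, ev_add, ev_smul] at this
    push_cast at this ⊢
    linear_combination this
  obtain ⟨M, hM⟩ := isCompact_univ.exists_bound_of_continuousOn (continuous_ev (T g)).continuousOn
  obtain ⟨k, hk⟩ := exists_nat_gt (M / δ)
  have h1 := hM (φ.symm (x k)) (Set.mem_univ _)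
  rw [hg, norm_mul, Complex.norm_real, Real.norm_natCast] at h1
  rw [div_lt_iff₀ hδ] at hk
  nlinarith [mul_le_mul_of_nonneg_left (hx k).1.le (Nat.cast_nonneg (α := ℝ) k)]

lemma exists_ev_eq_I [CompactSpace L] [T2Space L] (hF : IsClosed F) {s : L} (hs : s ∉ F) :
    ∃ f : Cr L F, ev f s = Complex.I := by
  obtain ⟨χ, h0, h1, -⟩ := exists_continuous_zero_one_of_isClosed hF (isClosed_singleton (x := s))
    (Set.disjoint_singleton_right.2 hs)
  refine ⟨mk (fun t => χ t * Complex.I) (by fun_prop) fun t ht => by simp [h0 ht], ?_⟩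
  simp [h1 (Set.mem_singleton s)]

lemma support_map_notMem [CompactSpace L₂] [T2Space L₂] (hF₂ : IsClosed F₂)
    {T : Cr L₁ F₁ →ₗ[ℝ] Cr L₂ F₂} (hsurj : Function.Surjective T) (φ : L₂ ≃ₜ L₁)
    (hφ : ∀ f s, s ∈ tsupport (ev (T f)) → φ s ∈ tsupport (ev f)) {s : L₂} (hs : s ∉ F₂) :
    φ s ∉ F₁ := by
  intro hmem
  obtain ⟨g, hg⟩ := exists_ev_eq_I hF₂ hs
  obtain ⟨f₂, rfl⟩ := hsurj g
  obtain ⟨f₁, hf₁⟩ := hsurj 1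
  have him₁ := im_ev f₁ hmem
  have him₂ := im_ev f₂ hmem
  have h := ev_eq_zero_of_ev_support_eq_zero T φ hφ
    ((ev f₂ (φ s)).re • f₁ + (-(ev f₁ (φ s)).re) • f₂) s (by
      apply Complex.ext <;> simp [him₁, him₂]; ring)
  have hre : (ev f₁ (φ s)).re = 0 := by
    have := congrArg Complex.im h
    rw [map_add, map_smul, map_smul, ev_add, ev_smul, ev_smul, hf₁, hg] at this
    simpa using this
  have h1 := ev_eq_zero_of_ev_support_eq_zero T φ hφ f₁ s (Complex.ext hre him₁)
  simp [hf₁] at h1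

end Cr

/-- If there exists a bi-orthogonality preserving real-linear bijection
`T : C_r(L₁) → C_r(L₂)`, then there is a homeomorphism `φ : L₂ → L₁` with `φ(F₂) = F₁` and
`φ(O₂) = O₁` (where `Oᵢ = Lᵢ \ Fᵢ`); in particular `L₁` and `L₂` are homeomorphic. -/
theorem stmt_9 {L₁ L₂ : Type*}
    [TopologicalSpace L₁] [CompactSpace L₁] [T2Space L₁]
    [TopologicalSpace L₂] [CompactSpace L₂] [T2Space L₂]
    (F₁ : Set L₁) (F₂ : Set L₂) (hF₁ : IsClosed F₁) (hF₂ : IsClosed F₂)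
    (hex : ∃ T : Cr L₁ F₁ →ₗ[ℝ] Cr L₂ F₂, Function.Bijective T ∧
      ∀ f g : Cr L₁ F₁, f * g = 0 ↔ T f * T g = 0) :
    ∃ φ : L₂ ≃ₜ L₁, ⇑φ '' F₂ = F₁ ∧ ⇑φ '' F₂ᶜ = F₁ᶜ := by
  obtain ⟨T, hbij, hT⟩ := hex
  let e := LinearEquiv.ofBijective T hbij
  have hTe : ∀ f, T (e.symm f) = f := e.apply_symm_apply
  have heT : ∀ f, e.symm (T f) = f := e.symm_apply_apply
  obtain ⟨φ, hφc, hφ⟩ := Cr.exists_support_map T (fun f g => (hT f g).1) hbij.2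
  obtain ⟨ψ, hψc, hψ⟩ := Cr.exists_support_map e.symm.toLinearMap
    (fun f g h => (hT (e.symm f) (e.symm g)).2 (by rw [hTe, hTe]; exact h)) e.symm.surjective
  have hψ' : ∀ f t, t ∈ tsupport (Cr.ev f) → ψ t ∈ tsupport (Cr.ev (T f)) := fun f t ht =>
    hψ (T f) t (by change t ∈ tsupport (Cr.ev (e.symm (T f))); rwa [heT])
  have hφ' : ∀ f s, s ∈ tsupport (Cr.ev f) →
      φ s ∈ tsupport (Cr.ev (e.symm.toLinearMap f)) := fun f s hs =>
    hφ (e.symm f) s (by rwa [hTe])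
  let Φ : L₂ ≃ₜ L₁ :=
    { toFun := φ
      invFun := ψ
      left_inv := Cr.support_map_comp hbij.2 hφ hψ'
      right_inv := Cr.support_map_comp e.symm.surjective hψ hφ'
      continuous_toFun := hφc
      continuous_invFun := hψc }
  have h₂ : ∀ s, s ∉ F₂ → Φ s ∉ F₁ := fun s hs =>
    Cr.support_map_notMem hF₂ hbij.2 Φ hφ hs
  have h₁ : ∀ t, t ∉ F₁ → Φ.symm t ∉ F₂ := fun t ht =>
    Cr.support_map_notMem hF₁ e.symm.surjective Φ.symm hψ ht
  have himage : Φ '' F₂ = F₁ := by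
    ext t
    rw [← Φ.preimage_symm]
    exact ⟨not_imp_not.1 (h₁ t), fun ht => not_imp_not.1 (h₂ (Φ.symm t)) (by simpa using ht)⟩
  exact ⟨Φ, himage, by rw [Set.image_compl_eq Φ.bijective, himage]⟩
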